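/- arXiv:2506.13547 — 2 statements merged into one kernel-verified Lean document; each statement's English description precedes it below -/
import Mathlib

section
/- Let m ≥ 2 and let A ⊆ [m] with A ≠ ∅ and A ≠ [m]; write A^c := [m]∖A. Then in ℝ^{m−1} the following two unions of cones coincide: ⋃_{i∈A} C(A∖{i}, A^c) = ⋃_{j∈A^c} C(A, A^c∖{j}). -/
open Finset

/-- The vectors `e_1, ..., e_m` in `ℝ^{m-1}`: for `i` with `(i : ℕ) < m - 1` this is the
standard basis vector, and the last one is `e_m = -(e_1 + ⋯ + e_{m-1})`,
i.e. the all-(-1) vector. -/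
noncomputable def bierVec (m : ℕ) (i : Fin m) : Fin (m - 1) → ℝ :=
  if h : (i : ℕ) < m - 1 then Pi.single ⟨i, h⟩ 1 else fun _ => -1

/-- The cone `C(I, J)`: all nonnegative combinations of the `-e_i`, `i ∈ I`,
and the `e_j`, `j ∈ J`. -/
def coneC (m : ℕ) (I J : Finset (Fin m)) : Set (Fin (m - 1) → ℝ) :=
  {x | ∃ a b : Fin m → ℝ, (∀ i, 0 ≤ a i) ∧ (∀ j, 0 ≤ b j) ∧
    x = ∑ i ∈ I, a i • (-(bierVec m i)) + ∑ j ∈ J, b j • bierVec m j}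

/-- `K` is a simplicial complex on `[m]` (with ghost vertices allowed):
a nonempty collection of subsets of `[m]` closed under passing to subsets. -/
def IsSimplicialComplex (m : ℕ) (K : Finset (Finset (Fin m))) : Prop :=
  K.Nonempty ∧ ∀ s ∈ K, ∀ t ⊆ s, t ∈ K

/-- `(I, J)` is a face of the Bier sphere `Bier(K)`: `I` and `J` are disjoint,
`I ∈ K` and `J ∈ K^∨`, i.e. `[m] \ J ∉ K`. -/
def IsBierFace (m : ℕ) (K : Finset (Finset (Fin m))) (I J : Finset (Fin m)) : Prop :=
  Disjoint I J ∧ I ∈ K ∧ Finset.univ \ J ∉ K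

theorem sum_bierVec_eq_zero (m : ℕ) (hm : 1 ≤ m) : ∑ i, bierVec m i = 0 := by
  obtain ⟨n, rfl⟩ := Nat.exists_eq_add_of_le' hm
  ext (k : Fin n)
  rw [Finset.sum_apply, Fin.sum_univ_castSucc]
  simp [bierVec, Pi.single_apply]

/-- Subtracting a constant from all coefficients does not change a combination of the
`bierVec m i`, as these vectors sum to zero. -/
theorem sum_sub_smul_bierVec (m : ℕ) (hm : 1 ≤ m) (c : Fin m → ℝ) (t : ℝ) :
    ∑ k, (c k - t) • bierVec m k = ∑ k, c k • bierVec m k := by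
  simp_rw [sub_smul, Finset.sum_sub_distrib, ← Finset.smul_sum, sum_bierVec_eq_zero m hm,
    smul_zero, sub_zero]

/-- Points of `C(I, J)` are described by one coefficient vector that is nonpositive on `I`,
nonnegative on `J` and zero elsewhere. -/
theorem mem_coneC_iff (m : ℕ) {I J : Finset (Fin m)} (h : Disjoint I J)
    (x : Fin (m - 1) → ℝ) :
    x ∈ coneC m I J ↔ ∃ c : Fin m → ℝ, (∀ i ∈ I, c i ≤ 0) ∧ (∀ j ∈ J, 0 ≤ c j) ∧
      (∀ k, k ∉ I → k ∉ J → c k = 0) ∧ x = ∑ k, c k • bierVec m k := by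
  constructor
  · rintro ⟨a, b, ha, hb, rfl⟩
    refine ⟨fun k => (if k ∈ I then -a k else 0) + (if k ∈ J then b k else 0), ?_, ?_, ?_, ?_⟩
    · intro i hi
      simp [hi, Finset.disjoint_left.mp h hi, ha i]
    · intro j hj
      simp [hj, Finset.disjoint_right.mp h hj, hb j]
    · intro k hI hJ
      simp [hI, hJ]
    · simp [add_smul, Finset.sum_add_distrib, ite_smul]
  · rintro ⟨c, hI, hJ, h0, rfl⟩
    refine ⟨fun k => |c k|, fun k => |c k|, fun k => abs_nonneg _, fun k => abs_nonneg _, ?_⟩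
    have h1 : ∑ i ∈ I, |c i| • (-(bierVec m i)) = ∑ i ∈ I, c i • bierVec m i :=
      Finset.sum_congr rfl fun i hi => by
        rw [abs_of_nonpos (hI i hi), smul_neg, neg_smul, neg_neg]
    have h2 : ∑ j ∈ J, |c j| • bierVec m j = ∑ j ∈ J, c j • bierVec m j :=
      Finset.sum_congr rfl fun j hj => by rw [abs_of_nonneg (hJ j hj)]
    rw [h1, h2, ← Finset.sum_union h]
    refine (Finset.sum_subset (Finset.subset_univ _) fun k _ hk => ?_).symm
    rw [Finset.mem_union, not_or] at hk
    rw [h0 k hk.1 hk.2, zero_smul]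

/-- For `∅ ≠ A ⊊ [m]`, the union of the cones `C(A \ {i}, A^c)` over `i ∈ A` coincides
with the union of the cones `C(A, A^c \ {j})` over `j ∈ A^c`. -/
theorem bier_cone_unions_eq (m : ℕ) (hm : 2 ≤ m) (A : Finset (Fin m))
    (hA1 : A ≠ ∅) (hA2 : A ≠ Finset.univ) :
    (⋃ i ∈ A, coneC m (A.erase i) (Finset.univ \ A)) =
      ⋃ j ∈ Finset.univ \ A, coneC m A ((Finset.univ \ A).erase j) := by
  have hd : Disjoint A (Finset.univ \ A) := Finset.disjoint_sdiff
  have hm1 : 1 ≤ m := by omega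
  have hd1 (i : Fin m) : Disjoint (A.erase i) (Finset.univ \ A) :=
    hd.mono_left (Finset.erase_subset _ _)
  have hd2 (j : Fin m) : Disjoint A ((Finset.univ \ A).erase j) :=
    hd.mono_right (Finset.erase_subset _ _)
  ext x
  simp only [Set.mem_iUnion, exists_prop, mem_coneC_iff m (hd1 _), mem_coneC_iff m (hd2 _)]
  constructor
  · rintro ⟨i, hi, c, hI, hJ, h0, rfl⟩
    have hne : (Finset.univ \ A).Nonempty := by
      rwa [Finset.sdiff_nonempty, Finset.univ_subset_iff]
    obtain ⟨j, hj, hmin⟩ := Finset.exists_min_image _ c hne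
    refine ⟨j, hj, fun k => c k - c j, ?_, ?_, ?_, (sum_sub_smul_bierVec m hm1 c _).symm⟩
    · intro k hk
      have := hJ j hj
      have : c k ≤ 0 := by
        by_cases hki : k = i
        · exact (h0 k (by simp [hki]) (by simp [hk])).le
        · exact hI k (Finset.mem_erase.mpr ⟨hki, hk⟩)
      linarith
    · exact fun k hk => sub_nonneg.mpr (hmin k (Finset.mem_of_mem_erase hk))
    · intro k hkA hk
      have : k = j := by simpa [hkA] using hk
      simp [this]
  · rintro ⟨j, hj, c, hI, hJ, h0, rfl⟩
    obtain ⟨i, hi, hmax⟩ := Finset.exists_max_image _ c (Finset.nonempty_iff_ne_empty.mpr hA1)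
    refine ⟨i, hi, fun k => c k - c i, ?_, ?_, ?_, (sum_sub_smul_bierVec m hm1 c _).symm⟩
    · exact fun k hk => sub_nonpos.mpr (hmax k (Finset.mem_of_mem_erase hk))
    · intro k hk
      have := hI i hi
      have : 0 ≤ c k := by
        by_cases hkj : k = j
        · exact (h0 k (by simpa using hk) (by simp [hkj])).ge
        · exact hJ k (Finset.mem_erase.mpr ⟨hkj, hk⟩)
      linarith
    · intro k hk hkA
      have hkA' : k ∈ A := by simpa using hkA
      have : k = i := by simpa [hkA'] using hk
      simp [this]
end

section
/- Let m ≥ 2. For every x ∈ ℝ^{m−1} there exists exactly one proper subset J ⊊ [m] such that x is a linear combination of the vectors {e_j : j ∈ J} with all coefficients strictly positive (where e_m := −(e_1+⋯+e_{m−1}), and x = 0 corresponds to J = ∅). In other words, the cones C(∅,J), J ⊊ [m], constitute a complete simplicial fan in ℝ^{m−1} whose underlying simplicial complex is the boundary ∂Δ_{[m]} of the simplex. -/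
open Finset

/-- The coordinates of a linear combination of the `e_j`. -/
theorem sum_smul_bierVec_apply (n : ℕ) (b : Fin (n + 1) → ℝ) (k : Fin n) :
    (∑ j, b j • bierVec (n + 1) j) k = b k.castSucc - b (Fin.last n) := by
  have hcast (i : Fin n) : bierVec (n + 1) i.castSucc = Pi.single i 1 := by
    simp [bierVec]
  have hlast : bierVec (n + 1) (Fin.last n) = fun _ => -1 := by
    simp [bierVec]
  rw [Fin.sum_univ_castSucc, hlast]
  simp only [hcast]
  rw [Pi.add_apply, Finset.sum_apply]
  simp [Pi.single_apply, sub_eq_add_neg]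

/-- A vector is the combination of the `e_j` with coefficients `b` exactly when `b` differs
from `(x, 0)` by a constant. -/
theorem eq_sum_smul_bierVec_iff (n : ℕ) (x : Fin n → ℝ) (b : Fin (n + 1) → ℝ) :
    x = ∑ j, b j • bierVec (n + 1) j ↔
      ∀ j, b j = Fin.snoc (α := fun _ => ℝ) x 0 j + b (Fin.last n) := by
  constructor
  · intro h j
    induction j using Fin.lastCases with
    | last => simp
    | cast k =>
      have hk := sum_smul_bierVec_apply n b k
      rw [← h] at hk
      simp [hk]
  · intro h
    funext k
    have hk := h k.castSucc
    rw [Fin.snoc_castSucc] at hk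
    exact (eq_sub_of_add_eq hk.symm).trans (sum_smul_bierVec_apply n b k).symm

/-- The cones `C(∅, J)`, `J ⊊ [m]`, form a complete simplicial fan in `ℝ^{m-1}` whose
underlying simplicial complex is `∂Δ_{[m]}`: every `x ∈ ℝ^{m-1}` is a strictly positive
combination of the `e_j`, `j ∈ J`, for exactly one proper subset `J ⊊ [m]`
(with `x = 0` corresponding to `J = ∅`). -/
theorem simplex_fan_complete (m : ℕ) (hm : 2 ≤ m) :
    ∀ x : Fin (m - 1) → ℝ, ∃! J : Finset (Fin m), J ≠ Finset.univ ∧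
      ∃ b : Fin m → ℝ, (∀ j ∈ J, 0 < b j) ∧ x = ∑ j ∈ J, b j • bierVec m j := by
  obtain ⟨n, rfl⟩ : ∃ n, m = n + 1 := ⟨m - 1, by omega⟩
  intro x
  let y : Fin (n + 1) → ℝ := Fin.snoc (α := fun _ => ℝ) x 0
  have hy_last : y (Fin.last n) = 0 := Fin.snoc_last ..
  obtain ⟨i₀, hi₀⟩ := Finite.exists_min y
  refine ⟨({j | y i₀ < y j} : Finset (Fin (n + 1))), ⟨?_, fun j => y j - y i₀, ?_, ?_⟩, ?_⟩
  · intro h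
    have := h ▸ Finset.mem_univ i₀
    simp at this
  · intro j hj
    simpa using hj
  · have hx : x = ∑ j, (y j - y i₀) • bierVec (n + 1) j := by
      rw [eq_sum_smul_bierVec_iff n x fun j => y j - y i₀]
      intro j
      change y j - y i₀ = y j + (y (Fin.last n) - y i₀)
      rw [hy_last]
      ring
    refine hx.trans (Finset.sum_subset (Finset.subset_univ _) ?_).symm
    intro j _ hj
    have hji : y j = y i₀ := le_antisymm (by simpa using hj) (hi₀ j)
    simp [hji]
  · rintro J ⟨hJ, b, hb, hx⟩
    let c : Fin (n + 1) → ℝ := fun j => if j ∈ J then b j else 0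
    have hc : ∀ j, c j = y j + c (Fin.last n) := by
      refine (eq_sum_smul_bierVec_iff n x c).1 (hx.trans ?_)
      simp [c, ite_smul, Finset.sum_ite_mem]
    have hc_pos (j) (hj : j ∈ J) : 0 < c j := by simpa [c, hj] using hb j hj
    have hc_zero (j) (hj : j ∉ J) : c j = 0 := by simp [c, hj]
    obtain ⟨k, hk⟩ : ∃ k, k ∉ J := by
      by_contra! h
      exact hJ (Finset.eq_univ_iff_forall.2 h)
    have hi₀J : i₀ ∉ J := fun h => by
      linarith [hc_pos i₀ h, hc_zero k hk, hc i₀, hc k, hi₀ k]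
    ext j
    simp only [Finset.mem_filter, Finset.mem_univ, true_and]
    constructor
    · intro hj
      linarith [hc_pos j hj, hc_zero i₀ hi₀J, hc i₀, hc j]
    · intro hj
      by_contra hjJ
      linarith [hc_zero j hjJ, hc_zero i₀ hi₀J, hc i₀, hc j]
end
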